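/- Fix 0 < κ < 1/8. Define f : [0,1) → [0,∞) by f(s) = 0 for s ∈ [0, 1−κ] and f(s) = −log[1 − ((s − 1 + κ)/κ)²] for s ∈ (1−κ, 1). Let φ ≥ 0 be a smooth function on ℝ with φ(s) = 0 for s ≤ 1 − κ + κ², φ(s) = 1 for s ≥ 1 − κ + 2κ², and 0 ≤ φ' ≤ 2/κ². Define 𝔉(s) = ∫_0^s φ(τ) f'(τ) dτ. Then 𝔉 ≥ 0 is smooth on [0,1) and satisfies: (i) 𝔉(s) = 0 for 0 ≤ s ≤ 1 − κ + κ²; (ii) 𝔉' ≥ 0 and for every k ≥ 1 the function exp(−k𝔉) 𝔉^{(k)} is uniformly bounded on [0,1); (iii) for every 1 − 2κ < s < 1 there exists τ > 0 with 0 < s − τ < s + τ < 1 such that 1 ≤ exp(𝔉(s+τ) − 𝔉(s−τ)) ≤ 1 + c_2 κ and τ exp(𝔉(s−τ)) ≥ c_3 κ², where c_2, c_3 > 0 are absolute constants. -/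

import Mathlib

open Set

/-- If `exp (-F)` extends smoothly from `(-∞, b)` to `ℝ`, then so does every
`exp (-k F) F^{(k)}` with `k ≥ 1`. -/
lemma exists_contDiff_eq_exp_neg_mul_iteratedDeriv {F G : ℝ → ℝ} {b : ℝ}
    (hG : ContDiff ℝ (⊤ : ℕ∞) G) (hF : ∀ s < b, DifferentiableAt ℝ F s)
    (hFG : ∀ s < b, Real.exp (-F s) = G s) (k : ℕ) :
    ∃ H : ℝ → ℝ, ContDiff ℝ (⊤ : ℕ∞) H ∧ ∀ s < b,
      Real.exp (-((k + 1 : ℕ) : ℝ) * F s) * iteratedDeriv (k + 1) F s = H s := by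
  have hderivG : ContDiff ℝ (⊤ : ℕ∞) (deriv G) := (contDiff_infty_iff_deriv.1 hG).2
  have hG' : ∀ s < b, deriv G s = -(Real.exp (-F s) * deriv F s) := by
    intro s hs
    have h1 : G =ᶠ[nhds s] fun t => Real.exp (-F t) := by
      filter_upwards [Iio_mem_nhds hs] with t ht using (hFG t ht).symm
    rw [h1.deriv_eq]
    exact ((hF s hs).hasDerivAt.fun_neg.exp).deriv.trans (mul_neg _ _)
  induction k with
  | zero =>
    refine ⟨fun s => -deriv G s, hderivG.neg, fun s hs => ?_⟩
    simp [hG' s hs, iteratedDeriv_one]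
  | succ k ih =>
    obtain ⟨H, hH, hHF⟩ := ih
    have hderivH : ContDiff ℝ (⊤ : ℕ∞) (deriv H) := (contDiff_infty_iff_deriv.1 hH).2
    refine ⟨fun s => G s * deriv H s + ((k + 1 : ℕ) : ℝ) * (-deriv G s) * H s,
      (hG.mul hderivH).add ((contDiff_const.mul hderivG.neg).mul hH), fun s hs => ?_⟩
    have h1 : iteratedDeriv (k + 1) F =ᶠ[nhds s]
        fun t => Real.exp (((k + 1 : ℕ) : ℝ) * F t) * H t := by
      filter_upwards [Iio_mem_nhds hs] with t ht
      rw [← hHF t ht, ← mul_assoc, ← Real.exp_add, neg_mul, add_neg_cancel, Real.exp_zero,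
        one_mul]
    have hHd : HasDerivAt H (deriv H s) s :=
      ((contDiff_infty_iff_deriv.1 hH).1 s).hasDerivAt
    have h2 := ((((hF s hs).hasDerivAt.const_mul ((k + 1 : ℕ) : ℝ)).exp).mul hHd).deriv
    have h3 : Real.exp (-((k + 1 + 1 : ℕ) : ℝ) * F s) * Real.exp (((k + 1 : ℕ) : ℝ) * F s)
        = Real.exp (-F s) := by
      rw [← Real.exp_add]
      congr 1
      push_cast
      ring
    have h4 : iteratedDeriv (k + 1 + 1) F s =
        Real.exp (((k + 1 : ℕ) : ℝ) * F s) * (((k + 1 : ℕ) : ℝ) * deriv F s) * H s +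
          Real.exp (((k + 1 : ℕ) : ℝ) * F s) * deriv H s := by
      rw [iteratedDeriv_succ, h1.deriv_eq]
      exact h2
    simp only [h4, hG' s hs, ← hFG s hs]
    linear_combination (((k + 1 : ℕ) : ℝ) * deriv F s * H s + deriv H s) * h3

/-- The smooth density on `(-∞, 1)` of the truncated barrier
`-log (1 - ((s - 1 + κ) / κ) ^ 2)`. -/
noncomputable def cutoffDensity (κ : ℝ) (φ : ℝ → ℝ) (s : ℝ) : ℝ :=
  φ s * (2 * (s - 1 + κ) / ((1 - s) * (s - 1 + 2 * κ)))

lemma hasDerivAt_neg_log_one_sub_sq {κ s : ℝ} (hκ : 0 < κ) (hs : 1 - κ < s) (hs1 : s < 1) :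
    HasDerivAt (fun s : ℝ => -Real.log (1 - ((s - 1 + κ) / κ) ^ 2))
      (2 * (s - 1 + κ) / ((1 - s) * (s - 1 + 2 * κ))) s := by
  have h1 : 1 - ((s - 1 + κ) / κ) ^ 2 = (1 - s) * (s - 1 + 2 * κ) / κ ^ 2 := by
    field_simp
    ring
  have h2 : 0 < 1 - s := by linarith
  have h3 : 0 < s - 1 + 2 * κ := by linarith
  have h4 : 1 - ((s - 1 + κ) / κ) ^ 2 ≠ 0 := by
    rw [h1]
    positivity
  have h5 := (((((((hasDerivAt_id s).sub_const 1).add_const κ).div_const κ).fun_pow 2).const_sub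
    1).log h4).fun_neg
  refine h5.congr_deriv ?_
  simp only [id, h1, Nat.cast_ofNat, Nat.add_one_sub_one, pow_one]
  have := h2.ne'
  have := h3.ne'
  field_simp

lemma cutoffDensity_eq {κ : ℝ} {φ : ℝ → ℝ} (hκ : 0 < κ)
    (hφ0 : ∀ s, s ≤ 1 - κ + κ ^ 2 → φ s = 0) {s : ℝ} (hs : s < 1) :
    φ s * deriv (fun s : ℝ =>
      if s ≤ 1 - κ then 0 else -Real.log (1 - ((s - 1 + κ) / κ) ^ 2)) s =
      cutoffDensity κ φ s := by
  rw [cutoffDensity]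
  rcases le_or_gt s (1 - κ) with h | h
  · rw [hφ0 s (by nlinarith), zero_mul, zero_mul]
  · congr 1
    have h1 : (fun s : ℝ => if s ≤ 1 - κ then 0 else -Real.log (1 - ((s - 1 + κ) / κ) ^ 2))
        =ᶠ[nhds s] fun s => -Real.log (1 - ((s - 1 + κ) / κ) ^ 2) := by
      filter_upwards [Ioi_mem_nhds h] with t ht
      exact if_neg (not_le.2 ht)
    rw [h1.deriv_eq, (hasDerivAt_neg_log_one_sub_sq hκ h hs).deriv]

lemma contDiffOn_cutoffDensity {κ : ℝ} {φ : ℝ → ℝ} (hκ : 0 < κ)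
    (hφ : ContDiff ℝ (⊤ : ℕ∞) φ) (hφ0 : ∀ s, s ≤ 1 - κ + κ ^ 2 → φ s = 0) :
    ContDiffOn ℝ (⊤ : ℕ∞) (cutoffDensity κ φ) (Iio 1) := by
  intro s hs
  apply ContDiffAt.contDiffWithinAt
  have hs : s < 1 := hs
  rcases lt_or_ge s (1 - κ + κ ^ 2) with h | h
  · refine (contDiffAt_const (c := (0 : ℝ))).congr_of_eventuallyEq ?_
    filter_upwards [Iio_mem_nhds h] with t ht
    rw [cutoffDensity, hφ0 t (le_of_lt ht), zero_mul]
  · have h2 : 0 < 1 - s := by linarith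
    have h3 : 0 < s - 1 + 2 * κ := by nlinarith
    refine hφ.contDiffAt.mul (ContDiffAt.div (by fun_prop) (by fun_prop) ?_)
    positivity

lemma cutoffDensity_nonneg {κ : ℝ} {φ : ℝ → ℝ} (hκ : 0 < κ) (hφ : ∀ s, 0 ≤ φ s)
    (hφ0 : ∀ s, s ≤ 1 - κ + κ ^ 2 → φ s = 0) {s : ℝ} (hs : s < 1) :
    0 ≤ cutoffDensity κ φ s := by
  rw [cutoffDensity]
  rcases lt_or_ge s (1 - κ + κ ^ 2) with h | h
  · rw [hφ0 s h.le, zero_mul]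
  · have h2 : 0 < 1 - s := by linarith
    have h3 : 0 < s - 1 + κ := by nlinarith
    have h4 : 0 < s - 1 + 2 * κ := by linarith
    have := hφ s
    positivity

lemma cutoffDensity_le {κ : ℝ} {φ : ℝ → ℝ} (hκ : 0 < κ) (hφ : ∀ s, φ s ≤ 1)
    (hφ0 : ∀ s, s ≤ 1 - κ + κ ^ 2 → φ s = 0) {s : ℝ} (hs : s < 1) :
    cutoffDensity κ φ s ≤ 1 / (1 - s) := by
  rw [cutoffDensity]
  have h2 : 0 < 1 - s := by linarith
  rcases lt_or_ge s (1 - κ + κ ^ 2) with h | h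
  · rw [hφ0 s h.le, zero_mul]
    positivity
  · have h3 : 0 < s - 1 + κ := by nlinarith
    have h4 : 0 < s - 1 + 2 * κ := by linarith
    calc φ s * (2 * (s - 1 + κ) / ((1 - s) * (s - 1 + 2 * κ)))
        ≤ 1 * (2 * (s - 1 + κ) / ((1 - s) * (s - 1 + 2 * κ))) := by
          gcongr
          exact hφ s
      _ ≤ 1 / (1 - s) := by
          rw [one_mul, div_le_div_iff₀ (by positivity) h2]
          nlinarith

/-- Past the transition region, the exponential of the negated primitive is a quadratic
polynomial. -/
lemma exp_neg_eq_of_hasDerivAt_cutoffDensity {κ : ℝ} {φ F : ℝ → ℝ} (hκ : 0 < κ)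
    (hφ1 : ∀ s, 1 - κ + 2 * κ ^ 2 ≤ s → φ s = 1)
    (hF : ∀ s < 1, HasDerivAt F (cutoffDensity κ φ s) s) {s : ℝ}
    (hs : 1 - κ + 2 * κ ^ 2 ≤ s) (hs1 : s < 1) :
    Real.exp (-F s) = Real.exp (-F (1 - κ + 2 * κ ^ 2)) / (κ ^ 2 * (1 - 4 * κ ^ 2)) *
      ((1 - s) * (s - 1 + 2 * κ)) := by
  set a := 1 - κ + 2 * κ ^ 2 with ha
  have hd : ∀ x, a ≤ x → x < 1 →
      HasDerivAt (fun x => (1 - x) * (x - 1 + 2 * κ) * Real.exp (F x)) 0 x := by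
    intro x hx hx1
    have h1 := ((((hasDerivAt_id x).const_sub 1).mul
      (((hasDerivAt_id x).sub_const 1).add_const (2 * κ))).mul (hF x hx1).exp)
    refine h1.congr_deriv ?_
    have h2 : 1 - x ≠ 0 := by linarith
    have h3 : x - 1 + 2 * κ ≠ 0 := by nlinarith
    simp only [id, cutoffDensity, hφ1 x hx, Pi.mul_apply]
    field_simp
    ring
  have hconst := constant_of_has_deriv_right_zero (a := a) (b := s)
    (fun x hx => (hd x hx.1 (hx.2.trans_lt hs1)).continuousAt.continuousWithinAt)
    (fun x hx => (hd x hx.1 (hx.2.trans hs1)).hasDerivWithinAt) s ⟨hs, le_rfl⟩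
  have h1 : (1 - a) * (a - 1 + 2 * κ) = κ ^ 2 * (1 - 4 * κ ^ 2) := by
    rw [ha]
    ring
  simp only [h1] at hconst
  have h2 : 0 < κ ^ 2 * (1 - 4 * κ ^ 2) := by
    rw [← h1]
    have h3 : 0 < 1 - a := by linarith
    have h4 : 0 < a - 1 + 2 * κ := by nlinarith
    positivity
  rw [Real.exp_neg, Real.exp_neg, div_mul_eq_mul_div, eq_div_iff h2.ne', inv_mul_eq_div,
    inv_mul_eq_div, div_eq_div_iff (Real.exp_ne_zero _) (Real.exp_ne_zero _)]
  linear_combination -hconst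

lemma exists_contDiff_eq_exp_neg {κ : ℝ} {φ F : ℝ → ℝ} (hκ : 0 < κ) (hκ1 : κ < 1 / 8)
    (hφ1 : ∀ s, 1 - κ + 2 * κ ^ 2 ≤ s → φ s = 1)
    (hF : ∀ s < 1, HasDerivAt F (cutoffDensity κ φ s) s)
    (hFs : ContDiffOn ℝ (⊤ : ℕ∞) F (Iio 1)) :
    ∃ G : ℝ → ℝ, ContDiff ℝ (⊤ : ℕ∞) G ∧ ∀ s < 1, Real.exp (-F s) = G s := by
  set K := Real.exp (-F (1 - κ + 2 * κ ^ 2)) / (κ ^ 2 * (1 - 4 * κ ^ 2)) with hK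
  refine ⟨fun s => if s < 1 then Real.exp (-F s) else K * ((1 - s) * (s - 1 + 2 * κ)), ?_,
    fun s hs => (if_pos hs).symm⟩
  rw [contDiff_iff_contDiffAt]
  intro s
  rcases lt_or_ge s 1 with hs | hs
  · refine (hFs.contDiffAt (Iio_mem_nhds hs)).neg.exp.congr_of_eventuallyEq ?_
    filter_upwards [Iio_mem_nhds hs] with t ht using if_pos ht
  · have h1 : ContDiffAt ℝ (⊤ : ℕ∞) (fun s => K * ((1 - s) * (s - 1 + 2 * κ))) s := by
      fun_prop
    refine h1.congr_of_eventuallyEq ?_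
    have h2 : 1 - κ + 2 * κ ^ 2 < s := by nlinarith
    filter_upwards [Ioi_mem_nhds h2] with t ht
    split_ifs with h
    · exact exp_neg_eq_of_hasDerivAt_cutoffDensity hκ hφ1 hF (le_of_lt ht) h
    · rfl

/-- The primitive of the cutoff density grows at least like `-log (1 - s)`. -/
lemma le_one_sub_mul_exp {κ : ℝ} {φ F : ℝ → ℝ} (hκ : 0 < κ) (hκ1 : κ < 1 / 8)
    (hφ1 : ∀ s, 1 - κ + 2 * κ ^ 2 ≤ s → φ s = 1)
    (hF : ∀ s < 1, HasDerivAt F (cutoffDensity κ φ s) s)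
    (hF0 : ∀ s ∈ Ico (0 : ℝ) 1, 0 ≤ F s) {s : ℝ} (hs0 : 0 ≤ s) (hs1 : s < 1) :
    15 / 32 * κ ≤ (1 - s) * Real.exp (F s) := by
  have hk : κ ^ 2 < 1 / 64 := by nlinarith
  rcases lt_or_ge s (1 - κ + 2 * κ ^ 2) with h | h
  · have h1 : 1 ≤ Real.exp (F s) := Real.one_le_exp (hF0 s ⟨hs0, hs1⟩)
    nlinarith
  · have h1 := exp_neg_eq_of_hasDerivAt_cutoffDensity hκ hφ1 hF h hs1
    have h2 : Real.exp (-F (1 - κ + 2 * κ ^ 2)) ≤ 1 :=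
      Real.exp_le_one_iff.2 (neg_nonpos.2 (hF0 _ ⟨by nlinarith, by nlinarith⟩))
    have h3 : Real.exp (-F (1 - κ + 2 * κ ^ 2)) / (κ ^ 2 * (1 - 4 * κ ^ 2)) ≤
        16 / (15 * κ ^ 2) := by
      rw [div_le_div_iff₀ (by nlinarith [sq_pos_of_pos hκ]) (by positivity)]
      nlinarith [sq_pos_of_pos hκ]
    have h4 : 0 < 1 - s := by linarith
    have h5 : 0 < s - 1 + 2 * κ := by nlinarith
    have h6 : Real.exp (-F s) ≤ 16 / (15 * κ ^ 2) * ((1 - s) * (2 * κ)) := by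
      rw [h1]
      gcongr
      linarith
    have h7 : 16 / (15 * κ ^ 2) * ((1 - s) * (2 * κ)) = (1 - s) / (15 / 32 * κ) := by
      field_simp
      ring
    rw [h7, le_div_iff₀ (by positivity)] at h6
    calc 15 / 32 * κ = Real.exp (-F s) * (15 / 32 * κ) * Real.exp (F s) := by
          rw [mul_right_comm, ← Real.exp_add]
          simp
      _ ≤ (1 - s) * Real.exp (F s) := by gcongr

lemma exists_exp_sub_le_and_le_mul_exp {κ : ℝ} {φ F : ℝ → ℝ} (hκ : 0 < κ) (hκ1 : κ < 1 / 8)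
    (hφ : ∀ s, 0 ≤ φ s) (hφle : ∀ s, φ s ≤ 1)
    (hφ0 : ∀ s, s ≤ 1 - κ + κ ^ 2 → φ s = 0)
    (hφ1 : ∀ s, 1 - κ + 2 * κ ^ 2 ≤ s → φ s = 1)
    (hF : ∀ s < 1, HasDerivAt F (cutoffDensity κ φ s) s)
    (hF0 : ∀ s ∈ Ico (0 : ℝ) 1, 0 ≤ F s) {s : ℝ} (hs : 1 - 2 * κ < s) (hs1 : s < 1) :
    ∃ τ : ℝ, 0 < τ ∧ 0 < s - τ ∧ s + τ < 1 ∧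
      1 ≤ Real.exp (F (s + τ) - F (s - τ)) ∧
      Real.exp (F (s + τ) - F (s - τ)) ≤ 1 + 4 * κ ∧
      1 / 10 * κ ^ 2 ≤ τ * Real.exp (F (s - τ)) := by
  have ha : 0 < 1 - s := by linarith
  have hmono : MonotoneOn F (Iio 1) :=
    monotoneOn_of_deriv_nonneg (convex_Iio 1)
      (fun x hx => (hF x hx).continuousAt.continuousWithinAt)
      (fun x hx => (hF x (interior_subset (s := Iio (1 : ℝ)) hx)).differentiableAt.differentiableWithinAt)
      (fun x hx => by
        have hx : x < 1 := interior_subset (s := Iio (1 : ℝ)) hx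
        rw [(hF x hx).deriv]
        exact cutoffDensity_nonneg hκ hφ hφ0 hx)
  have hτ0 : 0 < κ * (1 - s) / 2 := by positivity
  have hτ1 : κ * (1 - s) / 2 < (1 - s) / 2 := by nlinarith
  set τ := κ * (1 - s) / 2 with hτ
  have hlt : s + τ < 1 := by linarith
  have hup : F (s + τ) - F (s - τ) ≤ 2 * κ := by
    have h1 := (convex_Icc (s - τ) (s + τ)).image_sub_le_mul_sub_of_deriv_le (f := F)
      (C := 2 / (1 - s))
      (fun x hx => (hF x (hx.2.trans_lt hlt)).continuousAt.continuousWithinAt)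
      (fun x hx => (hF x ((interior_subset hx).2.trans_lt hlt)).differentiableAt.differentiableWithinAt)
      (fun x hx => by
        have hx := interior_subset hx
        have hx1 := hx.2.trans_lt hlt
        rw [(hF x hx1).deriv]
        refine (cutoffDensity_le hκ hφle hφ0 hx1).trans ?_
        rw [div_le_div_iff₀ (by linarith) ha]
        linarith [hx.2])
      (s - τ) ⟨le_rfl, by linarith⟩ (s + τ) ⟨by linarith, le_rfl⟩ (by linarith)
    refine h1.trans_eq ?_
    rw [hτ]
    field_simp
    ring
  have hlow : F s - F (s - τ) ≤ 1 / 4 := by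
    have h1 : F s ≤ F (s + τ) := hmono hs1 hlt (by linarith)
    linarith
  refine ⟨τ, hτ0, by linarith, hlt, ?_, ?_, ?_⟩
  · exact Real.one_le_exp (sub_nonneg.2
      (hmono (show s - τ < 1 by linarith) hlt (by linarith)))
  · refine (Real.exp_le_exp.2 hup).trans ?_
    have h1 := Real.abs_exp_sub_one_le (x := 2 * κ) (by rw [abs_of_pos] <;> linarith)
    rw [abs_of_pos (show 0 < 2 * κ by linarith)] at h1
    linarith [le_abs_self (Real.exp (2 * κ) - 1)]
  · have h1 := le_one_sub_mul_exp hκ hκ1 hφ1 hF hF0 (by linarith) hs1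
    have h2 : Real.exp (F s) * (3 / 4) ≤ Real.exp (F (s - τ)) := by
      calc Real.exp (F s) * (3 / 4) ≤ Real.exp (F s) * Real.exp (-(1 / 4)) := by
            gcongr
            linarith [Real.add_one_le_exp (-(1 / 4) : ℝ)]
        _ = Real.exp (F s - 1 / 4) := by rw [← Real.exp_add, sub_eq_add_neg]
        _ ≤ Real.exp (F (s - τ)) := Real.exp_le_exp.2 (by linarith)
    calc 1 / 10 * κ ^ 2 ≤ κ / 2 * (15 / 32 * κ) * (3 / 4) := by nlinarith [sq_nonneg κ]
      _ ≤ κ / 2 * ((1 - s) * Real.exp (F s)) * (3 / 4) := by gcongr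
      _ = τ * (Real.exp (F s) * (3 / 4)) := by rw [hτ]; ring
      _ ≤ τ * Real.exp (F (s - τ)) := by gcongr

/-- Lemma 4.4, exhaustion/cutoff lemma.  Fix `0 < κ < 1/8`.  Let
`f(s) = 0` on `[0, 1-κ]` and `f(s) = -log [1 - ((s-1+κ)/κ)²]` on `(1-κ, 1)`, and let
`φ ≥ 0` be smooth with `φ = 0` on `(-∞, 1-κ+κ²]`, `φ = 1` on `[1-κ+2κ², ∞)` and
`0 ≤ φ' ≤ 2/κ²`.  Put `𝔉(s) = ∫₀ˢ φ(τ) f'(τ) dτ`.  Then `𝔉 ≥ 0` is smooth on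
`[0,1)` and: (i) `𝔉 = 0` on `[0, 1-κ+κ²]`; (ii) `𝔉' ≥ 0` and, for every `k ≥ 1`,
`exp(-k𝔉) 𝔉^{(k)}` is uniformly bounded; (iii) for every `1-2κ < s < 1` there is
`τ > 0` with `0 < s-τ < s+τ < 1`,
`1 ≤ exp(𝔉(s+τ) - 𝔉(s-τ)) ≤ 1 + c₂ κ` and `τ exp(𝔉(s-τ)) ≥ c₃ κ²`,
where `c₂, c₃ > 0` are absolute constants. -/
theorem cutoff_function_lemma :
    ∃ c₂ : ℝ, 0 < c₂ ∧ ∃ c₃ : ℝ, 0 < c₃ ∧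
      ∀ κ : ℝ, 0 < κ → κ < 1 / 8 →
        ∀ φ : ℝ → ℝ, ContDiff ℝ (⊤ : ℕ∞) φ → (∀ s, 0 ≤ φ s) →
          (∀ s, s ≤ 1 - κ + κ ^ 2 → φ s = 0) →
          (∀ s, 1 - κ + 2 * κ ^ 2 ≤ s → φ s = 1) →
          (∀ s, 0 ≤ deriv φ s ∧ deriv φ s ≤ 2 / κ ^ 2) →
          let f : ℝ → ℝ := fun s =>
            if s ≤ 1 - κ then 0 else -Real.log (1 - ((s - 1 + κ) / κ) ^ 2)
          let F : ℝ → ℝ := fun s => ∫ τ in (0:ℝ)..s, φ τ * deriv f τ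
          (∀ s ∈ Set.Ico (0:ℝ) 1, 0 ≤ F s) ∧
          ContDiffOn ℝ (⊤ : ℕ∞) F (Set.Ico 0 1) ∧
          (∀ s : ℝ, 0 ≤ s → s ≤ 1 - κ + κ ^ 2 → F s = 0) ∧
          (∀ s ∈ Set.Ico (0:ℝ) 1, 0 ≤ deriv F s) ∧
          (∀ k : ℕ, 1 ≤ k → ∃ C : ℝ, ∀ s ∈ Set.Ico (0:ℝ) 1,
            |Real.exp (-(k : ℝ) * F s) * iteratedDeriv k F s| ≤ C) ∧
          (∀ s : ℝ, 1 - 2 * κ < s → s < 1 →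
            ∃ τ : ℝ, 0 < τ ∧ 0 < s - τ ∧ s + τ < 1 ∧
              1 ≤ Real.exp (F (s + τ) - F (s - τ)) ∧
              Real.exp (F (s + τ) - F (s - τ)) ≤ 1 + c₂ * κ ∧
              c₃ * κ ^ 2 ≤ τ * Real.exp (F (s - τ))) := by
  refine ⟨4, by norm_num, 1 / 10, by norm_num, ?_⟩
  intro κ hκ hκ1 φ hφ hφnn hφ0 hφ1 hφ' f F
  have hφle : ∀ s, φ s ≤ 1 := by
    have hmono : Monotone φ :=
      monotone_of_deriv_nonneg (contDiff_infty_iff_deriv.1 hφ).1 fun s => (hφ' s).1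
    intro s
    rcases le_or_gt (1 - κ + 2 * κ ^ 2) s with h | h
    · exact (hφ1 s h).le
    · exact (hmono h.le).trans (hφ1 _ le_rfl).le
  have hh := contDiffOn_cutoffDensity hκ hφ hφ0
  have hsub : ∀ s < (1 : ℝ), uIcc 0 s ⊆ Iio 1 := fun s hs x hx =>
    lt_of_le_of_lt hx.2 (max_lt one_pos hs)
  have hFeq : ∀ s < 1, F s = ∫ τ in (0 : ℝ)..s, cutoffDensity κ φ τ := fun s hs =>
    intervalIntegral.integral_congr fun x hx => cutoffDensity_eq hκ hφ0 (hsub s hs hx)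
  have hF : ∀ s < 1, HasDerivAt F (cutoffDensity κ φ s) s := by
    intro s hs
    have h1 := intervalIntegral.integral_hasDerivAt_right
      ((hh.continuousOn.mono (hsub s hs)).intervalIntegrable)
      (hh.continuousOn.stronglyMeasurableAtFilter isOpen_Iio s hs)
      (hh.continuousOn.continuousAt (Iio_mem_nhds hs))
    refine h1.congr_of_eventuallyEq ?_
    filter_upwards [Iio_mem_nhds hs] with t ht using hFeq t ht
  have hFs : ContDiffOn ℝ (⊤ : ℕ∞) F (Iio 1) :=
    (contDiffOn_infty_iff_deriv_of_isOpen isOpen_Iio).2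
      ⟨fun s hs => (hF s hs).differentiableAt.differentiableWithinAt,
        hh.congr fun s hs => (hF s hs).deriv⟩
  have hF0 : ∀ s ∈ Ico (0 : ℝ) 1, 0 ≤ F s := by
    intro s hs
    rw [hFeq s hs.2]
    exact intervalIntegral.integral_nonneg hs.1 fun x hx =>
      cutoffDensity_nonneg hκ hφnn hφ0 (hx.2.trans_lt hs.2)
  refine ⟨hF0, hFs.mono fun s hs => hs.2, ?_, ?_, ?_, ?_⟩
  · intro s hs0 hs
    refine (intervalIntegral.integral_congr (g := fun _ => (0 : ℝ)) fun x hx => ?_).trans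
      intervalIntegral.integral_zero
    rw [uIcc_of_le hs0] at hx
    simp [hφ0 x (hx.2.trans hs)]
  · intro s hs
    rw [(hF s hs.2).deriv]
    exact cutoffDensity_nonneg hκ hφnn hφ0 hs.2
  · intro k hk
    obtain ⟨k, rfl⟩ := Nat.exists_eq_add_of_le' hk
    obtain ⟨G, hG, hFG⟩ := exists_contDiff_eq_exp_neg hκ hκ1 hφ1 hF hFs
    obtain ⟨H, hH, hHF⟩ := exists_contDiff_eq_exp_neg_mul_iteratedDeriv hG
      (fun s hs => (hF s hs).differentiableAt) hFG k
    obtain ⟨C, hC⟩ := (isCompact_Icc (a := (0 : ℝ)) (b := 1)).exists_bound_of_continuousOn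
      hH.continuous.continuousOn
    refine ⟨C, fun s hs => ?_⟩
    rw [hHF s hs.2]
    exact hC s ⟨hs.1, hs.2.le⟩
  · intro s hs hs1
    exact exists_exp_sub_le_and_le_mul_exp hκ hκ1 hφnn hφle hφ0 hφ1 hF hF0 hs hs1
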